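/- Let n ≥ 3 be an integer and let s be a real number with s > (n−1)/(n−2). Then there is no pair of twice continuously differentiable functions x, y : [0,∞) → ℝ satisfying the system (S_s) for all t ≥ 0 together with the zero initial data x(0) = y(0) = x'(0) = y'(0) = 0. -/

import Mathlib

open Real Set Filter

/-- The ODE system (S_s):
`x'' = n − (1/s)(n−1)e^{−2x} − (n/2)((x')² + x'·y')` and
`y'' = n − (2 − 1/s)(n−1)e^{−2y} − (n/2)((y')² + x'·y')`, required at all points of `I`. -/
def SysS (n : ℕ) (s : ℝ) (x y : ℝ → ℝ) (I : Set ℝ) : Prop :=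
  ∀ t ∈ I,
    deriv (deriv x) t =
      (n : ℝ) - (1 / s) * ((n : ℝ) - 1) * Real.exp (-2 * x t)
        - ((n : ℝ) / 2) * ((deriv x t) ^ 2 + deriv x t * deriv y t) ∧
    deriv (deriv y) t =
      (n : ℝ) - (2 - 1 / s) * ((n : ℝ) - 1) * Real.exp (-2 * y t)
        - ((n : ℝ) / 2) * ((deriv y t) ^ 2 + deriv x t * deriv y t)

/-- Zero initial data: `x(0) = y(0) = x'(0) = y'(0) = 0`. -/
def ZeroInit (x y : ℝ → ℝ) : Prop :=
  x 0 = 0 ∧ y 0 = 0 ∧ deriv x 0 = 0 ∧ deriv y 0 = 0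

/-- Regularity of one component: the first derivative is differentiable at positive times. -/
lemma reg_pos {y : ℝ → ℝ} (hy : ContDiffOn ℝ 2 y (Ici (0 : ℝ))) {t : ℝ} (ht : 0 < t) :
    HasDerivAt y (deriv y t) t ∧ HasDerivAt (deriv y) (deriv (deriv y) t) t := by
  have h : ContDiffAt ℝ 2 y t := hy.contDiffAt (Ici_mem_nhds ht)
  refine ⟨(h.differentiableAt (by norm_num)).hasDerivAt, ?_⟩
  have h2 : ContDiffAt ℝ 1 (deriv y) t := by
    have h3 := h.fderiv_right (m := 1) (by norm_num)
    exact h3.clm_apply contDiffAt_const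
  exact (h2.differentiableAt (by norm_num)).hasDerivAt

lemma key (N a b : ℝ) (hN : 3 ≤ N) (ha : 0 < a) (hb : N < b) (x y p q p' q' : ℝ → ℝ)
    (hy : ∀ t, 0 ≤ t → HasDerivWithinAt y (q t) (Ici t) t)
    (hyc : ContinuousOn y (Ici 0))
    (hyd : ∀ t, 0 < t → HasDerivAt y (q t) t)
    (hp : ∀ t, 0 ≤ t → HasDerivAt p (p' t) t)
    (hq : ∀ t, 0 ≤ t → HasDerivAt q (q' t) t)
    (hp' : ∀ t, 0 ≤ t → p' t = N - a * exp (-2 * x t) - (N / 2) * ((p t) ^ 2 + p t * q t))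
    (hq' : ∀ t, 0 ≤ t → q' t = N - b * exp (-2 * y t) - (N / 2) * ((q t) ^ 2 + p t * q t))
    (hy0 : y 0 = 0) (hp0 : p 0 = 0) (hq0 : q 0 = 0) : False := by
  have hpc : ∀ T, ContinuousOn p (Icc 0 T) := fun T t ht =>
    (hp t ht.1).continuousAt.continuousWithinAt
  have hqc : ∀ T, ContinuousOn q (Icc 0 T) := fun T t ht =>
    (hq t ht.1).continuousAt.continuousWithinAt
  have hycc : ∀ T, ContinuousOn y (Icc 0 T) := fun T => hyc.mono Icc_subset_Ici_self
  -- upper bound for the sum of the velocities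
  have hH : ∀ T, 0 ≤ T → p T + q T ≤ 2 := by
    intro T hT
    refine image_le_of_deriv_right_lt_deriv_boundary' (f := fun t => p t + q t)
      (f' := fun t => p' t + q' t) (B := fun _ => 2) (B' := fun _ => 0) (a := 0) (b := T)
      ((hpc T).add (hqc T)) (fun t ht => ((hp t ht.1).add (hq t ht.1)).hasDerivWithinAt)
      (by simp [hp0, hq0]) continuousOn_const (fun t _ => hasDerivWithinAt_const _ _ _)
      ?_ ⟨hT, le_rfl⟩
    intro t ht h
    rw [hp' t ht.1, hq' t ht.1]
    have h1 := mul_pos ha (exp_pos (-2 * x t))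
    have h2 := mul_pos (show 0 < b by linarith) (exp_pos (-2 * y t))
    have h3 : p t = 2 - q t := by linarith
    rw [h3]
    nlinarith
  -- signs
  have hneg : ∀ T, 0 ≤ T → y T ≤ 0 ∧ q T ≤ 0 := by
    intro T hT
    have hsub : Icc 0 T ⊆ {t | y t ≤ 0 ∧ q t ≤ 0} := by
      apply IsClosed.Icc_subset_of_forall_exists_gt
      · have h1 := (hycc T).preimage_isClosed_of_isClosed isClosed_Icc (isClosed_Iic (a := (0:ℝ)))
        have h2 := (hqc T).preimage_isClosed_of_isClosed isClosed_Icc (isClosed_Iic (a := (0:ℝ)))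
        convert h1.inter h2 using 1
        ext t
        simp only [mem_inter_iff, mem_ofPred_eq, mem_preimage, mem_Iic]
        tauto
      · exact ⟨hy0.le, hq0.le⟩
      · rintro t ⟨⟨hyt, hqt⟩, ht⟩ z hz
        have hev : ∀ᶠ r in nhdsWithin t (Ioi t), q r < 0 := by
          rcases hqt.lt_or_eq with h | h
          · exact ((hq t ht.1).continuousAt.eventually_lt_const h).filter_mono nhdsWithin_le_nhds
          · have hd : q' t < 0 := by
              rw [hq' t ht.1, h]
              have : 1 ≤ exp (-2 * y t) := one_le_exp (by linarith)
              nlinarith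
            have hs := (hq t ht.1).hasDerivWithinAt (s := Ioi t)
            rw [hasDerivWithinAt_iff_tendsto_slope' (by simp)] at hs
            filter_upwards [hs.eventually_lt_const hd, self_mem_nhdsWithin] with r hr hr2
            have hr3 : 0 < r - t := sub_pos.2 hr2
            rw [slope_def_field, h, sub_zero, div_lt_iff₀ hr3] at hr
            linarith
        obtain ⟨u, hu, hu2⟩ := (mem_nhdsGT_iff_exists_Ioo_subset' (show t < z from hz)).1 hev
        have hu : t < u := hu
        obtain ⟨r, hr1, hr2⟩ := exists_between (lt_min hu (show t < z from hz))
        have hru := lt_of_lt_of_le hr2 (min_le_left _ _)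
        have hrz := lt_of_lt_of_le hr2 (min_le_right _ _)
        refine ⟨r, ⟨?_, (hu2 ⟨hr1, hru⟩ : q r < 0).le⟩, hr1, hrz.le⟩
        have hanti : AntitoneOn y (Icc t r) := by
          apply antitoneOn_of_hasDerivWithinAt_nonpos (f' := q) (convex_Icc t r)
            (hyc.mono (fun w hw => le_trans ht.1 hw.1))
          · intro w hw
            rw [interior_Icc] at hw
            exact (hyd w (lt_of_le_of_lt ht.1 hw.1)).hasDerivWithinAt
          · intro w hw
            rw [interior_Icc] at hw
            exact (hu2 ⟨hw.1, hw.2.trans hru⟩ : q w < 0).le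
        exact (hanti ⟨le_rfl, hr1.le⟩ ⟨hr1.le, le_rfl⟩ hr1.le).trans hyt
    exact hsub ⟨hT, le_rfl⟩
  -- the barrier
  obtain ⟨c, hc0, hc1, hc⟩ : ∃ c : ℝ, 0 < c ∧ c < 1 ∧ c * (N + 1) < b - N := by
    refine ⟨(b - N) / (b + 1), by apply div_pos <;> linarith, ?_, ?_⟩
    · rw [div_lt_one (by linarith)]; linarith
    · rw [div_mul_eq_mul_div, div_lt_iff₀ (by linarith)]
      nlinarith
  have hw : ∀ T, 0 ≤ T → c * (exp (-y T) - 1) + q T ≤ 0 := by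
    intro T hT
    refine image_le_of_deriv_right_lt_deriv_boundary'
      (f := fun t => c * (exp (-y t) - 1) + q t)
      (f' := fun t => c * (exp (-y t) * (-q t)) + q' t) (B := fun _ => 0) (B' := fun _ => 0)
      (a := 0) (b := T) ?_ ?_
      (by simp [hy0, hq0]) continuousOn_const (fun t _ => hasDerivWithinAt_const _ _ _)
      ?_ ⟨hT, le_rfl⟩
    · exact (continuousOn_const.mul (((hycc T).neg.rexp).sub continuousOn_const)).add (hqc T)
    · intro t ht
      exact ((((hy t ht.1).neg.exp).sub_const 1).const_mul c).add (hq t ht.1).hasDerivWithinAt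
    · intro t ht h
      rw [hq' t ht.1]
      have hyt := (hneg t ht.1).1
      have hqt := (hneg t ht.1).2
      have hE : 1 ≤ exp (-y t) := one_le_exp (by linarith)
      have hE2 : exp (-2 * y t) = exp (-y t) ^ 2 := by
        rw [← exp_nat_mul]; congr 1; push_cast; ring
      rw [hE2]
      have hHt := hH t ht.1
      generalize exp (-y t) = E at *
      have hqe : q t = - (c * (E - 1)) := by linarith
      have h1 : -(N / 2) * ((q t) ^ 2 + p t * q t) ≤ N * (c * (E - 1)) := by
        have h2 : 0 ≤ (N / 2) * ((2 - (p t + q t)) * (- q t)) := by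
          apply mul_nonneg (by linarith) (mul_nonneg (by linarith) (by linarith))
        have h3 : N * (c * (E - 1)) = - N * q t := by rw [hqe]; ring
        rw [h3]; nlinarith
      have h4 : c * (E * (-q t)) ≤ c * E ^ 2 := by
        rw [hqe]
        have : E * - -(c * (E - 1)) ≤ E ^ 2 := by nlinarith
        exact mul_le_mul_of_nonneg_left this hc0.le
      have h5 : N * (c * (E - 1)) ≤ N * c * E ^ 2 := by
        have : E - 1 ≤ E ^ 2 := by nlinarith
        have := mul_le_mul_of_nonneg_left this (show 0 ≤ N * c by positivity)
        linarith
      have h6 : N ≤ N * E ^ 2 := le_mul_of_one_le_right (by linarith) (one_le_pow₀ hE)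
      have h7 : 0 < (b - N - c * (N + 1)) * E ^ 2 := by
        apply mul_pos (by linarith); positivity
      nlinarith
  -- strict negativity at time 1
  have hanti : AntitoneOn y (Ici 0) := by
    apply antitoneOn_of_hasDerivWithinAt_nonpos (f' := q) (convex_Ici 0) hyc
    · intro w hw
      rw [interior_Ici] at hw
      exact (hyd w hw).hasDerivWithinAt
    · intro w hw
      rw [interior_Ici] at hw
      exact (hneg w (le_of_lt hw)).2
  have hy1 : y 1 < 0 := by
    by_contra hcon
    have hz : ∀ t ∈ Ioo (0:ℝ) 1, y t = 0 := fun t ht =>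
      le_antisymm (hneg t ht.1.le).1
        ((not_lt.1 hcon).trans (hanti ht.1.le (by simp) ht.2.le))
    have hqz : ∀ t ∈ Ioo (0:ℝ) 1, q t = 0 := by
      intro t ht
      have he : y =ᶠ[nhds t] fun _ => 0 := by
        filter_upwards [Ioo_mem_nhds ht.1 ht.2] with r hr using hz r hr
      exact (hyd t ht.1).unique ((hasDerivAt_const t (0:ℝ)).congr_of_eventuallyEq he)
    have hm : (1/2 : ℝ) ∈ Ioo (0:ℝ) 1 := by norm_num
    have he : q =ᶠ[nhds (1/2 : ℝ)] fun _ => 0 := by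
      filter_upwards [Ioo_mem_nhds hm.1 hm.2] with r hr using hqz r hr
    have h := (hq _ hm.1.le).unique ((hasDerivAt_const _ (0:ℝ)).congr_of_eventuallyEq he)
    rw [hq' _ hm.1.le, hz _ hm, hqz _ hm] at h
    norm_num at h
    linarith
  -- exponential growth
  have hmono : MonotoneOn (fun t => (1 - exp (y t)) * exp (-c * t)) (Ici 1) := by
    apply monotoneOn_of_hasDerivWithinAt_nonneg
      (f' := fun t => (-(exp (y t) * q t)) * exp (-c * t)
        + (1 - exp (y t)) * (exp (-c * t) * (-c * 1))) (convex_Ici 1)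
    · exact ((continuousOn_const.sub
        (hyc.mono (Ici_subset_Ici.2 zero_le_one)).rexp)).mul (by fun_prop)
    · intro t ht
      rw [interior_Ici] at ht
      have h1 := (hyd t (zero_lt_one.trans ht)).exp.const_sub 1
      have h2 := ((hasDerivAt_id t).const_mul (-c)).exp
      exact (h1.mul h2).hasDerivWithinAt
    · intro t ht
      rw [interior_Ici] at ht
      have h := hw t (zero_le_one.trans (le_of_lt ht))
      have h1 : exp (y t) * (c * (exp (-y t) - 1) + q t) ≤ 0 :=
        mul_nonpos_of_nonneg_of_nonpos (exp_pos _).le h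
      have h2 : exp (y t) * exp (-y t) = 1 := by rw [← exp_add]; simp
      have h3 : 0 ≤ -(exp (y t) * q t) - c * (1 - exp (y t)) := by
        have : exp (y t) * (c * (exp (-y t) - 1) + q t)
          = c * (exp (y t) * exp (-y t)) - c * exp (y t) + exp (y t) * q t := by ring
        rw [this, h2] at h1
        linarith
      have := mul_nonneg h3 (exp_pos (-c * t)).le
      linarith
  have hk : 0 < (1 - exp (y 1)) * exp (-c * 1) :=
    mul_pos (by have := exp_lt_exp.2 hy1; rw [exp_zero] at this; linarith) (exp_pos _)
  have hlim : Tendsto (fun t : ℝ => exp (-c * t)) atTop (nhds 0) := by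
    apply tendsto_exp_atBot.comp
    exact tendsto_id.const_mul_atTop_of_neg (by linarith)
  obtain ⟨t, ht, ht1⟩ := ((hlim.eventually_lt_const hk).and (eventually_ge_atTop 1)).exists
  have h := hmono (show (1:ℝ) ∈ Ici 1 by simp) ht1 ht1
  simp only at h
  have := mul_pos (exp_pos (y t)) (exp_pos (-c * t))
  linarith

/-- For `n ≥ 3` and `s > (n−1)/(n−2)` there is no global (on `[0,∞)`) C² solution of
the system `(S_s)` with zero initial data. -/
theorem no_global_solution_nonequilibrium
    (n : ℕ) (hn : 3 ≤ n) (s : ℝ) (hs : ((n : ℝ) - 1) / ((n : ℝ) - 2) < s) :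
    ¬ ∃ x y : ℝ → ℝ,
        ContDiffOn ℝ 2 x (Ici (0 : ℝ)) ∧ ContDiffOn ℝ 2 y (Ici (0 : ℝ)) ∧
        SysS n s x y (Ici (0 : ℝ)) ∧ ZeroInit x y := by
  rintro ⟨x, y, hx, hy, hS, hx0, hy0, hp0, hq0⟩
  have hN : (3 : ℝ) ≤ n := by exact_mod_cast hn
  have hs0 : 0 < s := lt_trans (div_pos (by linarith) (by linarith)) hs
  have hlt : (1 / s) * ((n : ℝ) - 1) < n - 2 := by
    rw [div_lt_iff₀ (by linarith)] at hs
    rw [one_div_mul_eq_div, div_lt_iff₀ hs0]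
    linarith
  have ha : 0 < (1 / s) * ((n : ℝ) - 1) := mul_pos (by positivity) (by linarith)
  have hb : (n : ℝ) < (2 - 1 / s) * ((n : ℝ) - 1) := by linarith
  have h0 := hS 0 (by simp)
  rw [hx0, hy0, hp0, hq0] at h0
  norm_num at h0
  have hdx : DifferentiableAt ℝ (deriv x) 0 := by
    apply differentiableAt_of_deriv_ne_zero
    rw [h0.1]
    rw [one_div] at hlt
    linarith
  have hdy : DifferentiableAt ℝ (deriv y) 0 := by
    apply differentiableAt_of_deriv_ne_zero
    rw [h0.2]
    rw [one_div] at hb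
    linarith
  have hyd0 : HasDerivWithinAt y (deriv y 0) (Ici 0) 0 := by
    apply hasDerivWithinAt_Ici_of_tendsto_deriv (s := Ioi 0)
    · exact fun t ht => (reg_pos hy ht).1.differentiableAt.differentiableWithinAt
    · exact (hy.continuousOn 0 (by simp)).mono Ioi_subset_Ici_self
    · exact self_mem_nhdsWithin
    · exact hdy.continuousAt.tendsto.mono_left nhdsWithin_le_nhds
  refine key n _ _ hN ha hb x y (deriv x) (deriv y) (deriv (deriv x)) (deriv (deriv y))
    ?_ hy.continuousOn (fun t ht => (reg_pos hy ht).1) ?_ ?_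
    (fun t ht => (hS t ht).1) (fun t ht => (hS t ht).2) hy0 hp0 hq0
  · intro t ht
    rcases ht.eq_or_lt with rfl | h
    · exact hyd0
    · exact (reg_pos hy h).1.hasDerivWithinAt
  · intro t ht
    rcases ht.eq_or_lt with rfl | h
    · exact hdx.hasDerivAt
    · exact (reg_pos hx h).2
  · intro t ht
    rcases ht.eq_or_lt with rfl | h
    · exact hdy.hasDerivAt
    · exact (reg_pos hy h).2
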